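/- arXiv:0810.3173 — 3 statements merged into one kernel-verified Lean document; each statement's English description precedes it below -/
import Mathlib

section
/- There exists a constant K > 0, independent of n, such that P(D ∈ A₂ᶜ) ≤ K n e^{−β√n/4}, where A₂ᶜ is the event that D_i > n^{1/4} for some i = 1,…,n. -/
open Filter Real

/-- The unnormalized weight `f(k,γ) = (1/k!) exp(-βk² + γ k log n)`. -/
noncomputable def degWeight (β γ : ℝ) (n : ℕ) (k : ℕ) : ℝ :=
  (1 / (Nat.factorial k : ℝ)) * Real.exp (-β * (k : ℝ) ^ 2 + γ * Real.log n * k)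

/-- The probability mass function of `D₁`:
`P(D₁ = k) = F(γ)⁻¹ (1/k!) exp(-βk² + γ (log n) k)`. -/
noncomputable def degPMF (β γ : ℝ) (n : ℕ) (k : ℕ) : ℝ :=
  degWeight β γ n k / (∑' j : ℕ, degWeight β γ n j)

/-- The mean `E[D₁]`. -/
noncomputable def degMean (β γ : ℝ) (n : ℕ) : ℝ :=
  ∑' k : ℕ, (k : ℝ) * degPMF β γ n k

/-- The variance `Var(D₁)`. -/
noncomputable def degVar (β γ : ℝ) (n : ℕ) : ℝ :=
  ∑' k : ℕ, ((k : ℝ) - degMean β γ n) ^ 2 * degPMF β γ n k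

/-- A finite product of nonnegative summable families, summed over all index tuples. -/
theorem hasSum_fin_pi_prod {n : ℕ} (f : Fin n → ℕ → ℝ) (s : Fin n → ℝ)
    (hf : ∀ i k, 0 ≤ f i k) (hs : ∀ i, HasSum (f i) (s i)) :
    HasSum (fun d : Fin n → ℕ => ∏ i, f i (d i)) (∏ i, s i) := by
  induction n with
  | zero => simp
  | succ n ih =>
    have ih' := ih (fun i => f i.succ) (fun i => s i.succ) (fun i => hf _) (fun i => hs _)
    have hsum := (hs 0).summable.mul_of_nonneg ih'.summable (hf 0)
      (fun d => Finset.prod_nonneg fun i _ => hf _ _)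
    have h := (hs 0).mul ih' hsum
    rw [← (Fin.consEquiv (fun _ : Fin (n + 1) => ℕ)).hasSum_iff]
    simpa [Function.comp_def, Fin.prod_univ_succ, Fin.consEquiv] using h

/-- The union bound for an iid tuple with mass function `p`. -/
theorem tsum_exists_prod_le (n : ℕ) (p : ℕ → ℝ) (P : ℕ → Prop) [DecidablePred P]
    [DecidablePred fun d : Fin n → ℕ => ∃ i, P (d i)]
    (hp : ∀ k, 0 ≤ p k) (hp1 : HasSum p 1) :
    (∑' d : Fin n → ℕ, if ∃ i, P (d i) then ∏ i, p (d i) else 0)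
      ≤ n * ∑' k, if P k then p k else 0 := by
  set q : ℕ → ℝ := fun k => if P k then p k else 0 with hq
  have hq0 : ∀ k, 0 ≤ q k := fun k => by
    simp only [hq]; split_ifs
    exacts [hp k, le_rfl]
  have hqp : ∀ k, q k ≤ p k := fun k => by
    simp only [hq]; split_ifs
    exacts [le_rfl, hp k]
  have hqs : Summable q := hp1.summable.of_nonneg_of_le hq0 hqp
  let f : Fin n → Fin n → ℕ → ℝ := fun i j => if j = i then q else p
  have hf0 : ∀ i j k, 0 ≤ f i j k := fun i j k => by
    simp only [f]; split_ifs
    exacts [hq0 k, hp k]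
  have hf : ∀ i, HasSum (fun d : Fin n → ℕ => ∏ j, f i j (d j)) (∑' k, q k) := fun i => by
    have h := hasSum_fin_pi_prod (f i) (fun j => if j = i then ∑' k, q k else 1) (hf0 i)
      (fun j => by
        by_cases hj : j = i
        · simpa [f, hj] using hqs.hasSum
        · simpa [f, hj] using hp1)
    simpa [Finset.prod_ite_eq'] using h
  have hF := hasSum_sum (s := Finset.univ) fun i (_ : i ∈ Finset.univ) => hf i
  have hle : ∀ d : Fin n → ℕ, (if ∃ i, P (d i) then ∏ i, p (d i) else 0)
      ≤ ∑ i, ∏ j, f i j (d j) := fun d => by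
    have hnn : ∀ i ∈ Finset.univ, 0 ≤ ∏ j, f i j (d j) :=
      fun i _ => Finset.prod_nonneg fun j _ => hf0 i j _
    split_ifs with h
    · obtain ⟨i, hi⟩ := h
      refine le_trans (le_of_eq ?_) (Finset.single_le_sum hnn (Finset.mem_univ i))
      refine Finset.prod_congr rfl fun j _ => ?_
      by_cases hj : j = i
      · subst hj; simp [f, hq, hi]
      · simp [f, hj]
    · exact Finset.sum_nonneg hnn
  have hL : Summable fun d : Fin n → ℕ => if ∃ i, P (d i) then ∏ i, p (d i) else 0 :=
    hF.summable.of_nonneg_of_le (fun d => by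
      split_ifs
      exacts [Finset.prod_nonneg fun j _ => hp _, le_rfl]) hle
  refine (hL.tsum_le_tsum hle hF.summable).trans (le_of_eq ?_)
  rw [hF.tsum_eq]
  simp

theorem degWeight_pos (β γ : ℝ) (n k : ℕ) : 0 < degWeight β γ n k := by
  unfold degWeight; positivity

theorem summable_degWeight {β : ℝ} (hβ : 0 < β) (γ : ℝ) (n : ℕ) :
    Summable (degWeight β γ n) := by
  refine (Real.summable_pow_div_factorial (Real.exp (γ * Real.log n))).of_nonneg_of_le
    (fun k => (degWeight_pos β γ n k).le) fun k => ?_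
  rw [degWeight, ← Real.exp_nat_mul, one_div, div_eq_inv_mul]
  gcongr
  nlinarith [mul_nonneg hβ.le (sq_nonneg (k : ℝ))]

theorem one_le_tsum_degWeight {β : ℝ} (hβ : 0 < β) (γ : ℝ) (n : ℕ) :
    1 ≤ ∑' k, degWeight β γ n k := by
  have h := (summable_degWeight hβ γ n).le_tsum 0 fun k _ => (degWeight_pos β γ n k).le
  simpa [degWeight] using h

theorem degPMF_nonneg {β : ℝ} (hβ : 0 < β) (γ : ℝ) (n k : ℕ) : 0 ≤ degPMF β γ n k :=
  div_nonneg (degWeight_pos β γ n k).le (zero_le_one.trans (one_le_tsum_degWeight hβ γ n))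

theorem hasSum_degPMF {β : ℝ} (hβ : 0 < β) (γ : ℝ) (n : ℕ) : HasSum (degPMF β γ n) 1 := by
  have h := (summable_degWeight hβ γ n).hasSum.div_const (∑' k, degWeight β γ n k)
  rwa [div_self (by linarith [one_le_tsum_degWeight hβ γ n])] at h

theorem degPMF_le_degWeight {β : ℝ} (hβ : 0 < β) (γ : ℝ) (n k : ℕ) :
    degPMF β γ n k ≤ degWeight β γ n k :=
  div_le_self (degWeight_pos β γ n k).le (one_le_tsum_degWeight hβ γ n)

theorem succ_mul_degPMF_succ (β γ : ℝ) (n k : ℕ) :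
    ((k + 1 : ℕ) : ℝ) * degPMF β γ n (k + 1)
      = Real.exp (γ * Real.log n - β) * (Real.exp (-2 * β * k) * degPMF β γ n k) := by
  have h : ((k + 1 : ℕ) : ℝ) * degWeight β γ n (k + 1)
      = Real.exp (γ * Real.log n - β) * (Real.exp (-2 * β * k) * degWeight β γ n k) := by
    have e : Real.exp (-β * ((k + 1 : ℕ) : ℝ) ^ 2 + γ * Real.log n * ((k + 1 : ℕ) : ℝ))
        = Real.exp (γ * Real.log n - β) * (Real.exp (-2 * β * k)
          * Real.exp (-β * (k : ℝ) ^ 2 + γ * Real.log n * k)) := by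
      rw [← Real.exp_add, ← Real.exp_add]
      congr 1
      push_cast
      ring
    have hk : (Nat.factorial k : ℝ) ≠ 0 := by positivity
    have hk1 : ((k : ℝ) + 1) ≠ 0 := by positivity
    rw [degWeight, degWeight, e, Nat.factorial_succ]
    push_cast
    field_simp
  rw [degPMF, degPMF, ← mul_div_assoc, h]
  ring

theorem summable_exp_mul_degPMF {β : ℝ} (hβ : 0 < β) (γ : ℝ) (n : ℕ) :
    Summable fun k : ℕ => Real.exp (-2 * β * k) * degPMF β γ n k :=
  (hasSum_degPMF hβ γ n).summable.of_nonneg_of_le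
    (fun k => mul_nonneg (Real.exp_pos _).le (degPMF_nonneg hβ γ n k)) fun k =>
      mul_le_of_le_one_left (degPMF_nonneg hβ γ n k) <| Real.exp_le_one_iff.2 <| by
        nlinarith [mul_nonneg hβ.le (Nat.cast_nonneg (α := ℝ) k)]

theorem summable_mul_degPMF {β : ℝ} (hβ : 0 < β) (γ : ℝ) (n : ℕ) :
    Summable fun k : ℕ => (k : ℝ) * degPMF β γ n k := by
  rw [← summable_nat_add_iff 1]
  simp only [succ_mul_degPMF_succ]
  exact (summable_exp_mul_degPMF hβ γ n).mul_left _

theorem degMean_eq_exp_mul {β : ℝ} (hβ : 0 < β) (γ : ℝ) (n : ℕ) :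
    degMean β γ n = Real.exp (γ * Real.log n - β)
      * ∑' k : ℕ, Real.exp (-2 * β * k) * degPMF β γ n k := by
  rw [degMean, (summable_mul_degPMF hβ γ n).tsum_eq_zero_add]
  simp only [succ_mul_degPMF_succ, tsum_mul_left]
  simp

/-- Jensen's inequality for the exponential under the degree distribution. -/
theorem exp_degMean_le {β : ℝ} (hβ : 0 < β) (γ : ℝ) (n : ℕ) :
    Real.exp (-2 * β * degMean β γ n)
      ≤ ∑' k : ℕ, Real.exp (-2 * β * k) * degPMF β γ n k := by
  set m := degMean β γ n with hm
  have hM : HasSum (fun k : ℕ => (k : ℝ) * degPMF β γ n k) m :=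
    (summable_mul_degPMF hβ γ n).hasSum
  have h := ((((hasSum_degPMF hβ γ n).mul_left (1 + 2 * β * m)).sub
    (hM.mul_left (2 * β))).mul_left (Real.exp (-2 * β * m)))
  have h' := hasSum_le (fun k => ?_) h (summable_exp_mul_degPMF hβ γ n).hasSum
  · refine le_trans (le_of_eq ?_) h'
    ring
  · have e : Real.exp (-2 * β * k)
        = Real.exp (-2 * β * m) * Real.exp (-2 * β * k + 2 * β * m) := by
      rw [← Real.exp_add]; congr 1; ring
    rw [e, mul_assoc (Real.exp (-2 * β * m))]
    refine mul_le_mul_of_nonneg_left ?_ (Real.exp_pos _).le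
    have := mul_le_mul_of_nonneg_right (Real.add_one_le_exp (-2 * β * k + 2 * β * m))
      (degPMF_nonneg hβ γ n k)
    linarith

/-- The tilt is controlled linearly by the mean. -/
theorem tilt_le_degMean {β : ℝ} (hβ : 0 < β) (γ : ℝ) (n : ℕ) :
    γ * Real.log n ≤ β + (1 + 2 * β) * degMean β γ n := by
  have h := mul_le_mul_of_nonneg_left (exp_degMean_le hβ γ n)
    (Real.exp_pos (γ * Real.log n - β)).le
  rw [← degMean_eq_exp_mul hβ, ← Real.exp_add] at h
  have h' := Real.exp_le_exp.1 (h.trans ((le_add_of_nonneg_right zero_le_one).trans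
    (Real.add_one_le_exp (degMean β γ n))))
  linarith

theorem tail_degPMF_le {β : ℝ} (hβ : 0 < β) (γ : ℝ) (n : ℕ) (t : ℝ) (ht : 0 ≤ t)
    (h : γ * Real.log n ≤ 3 * β / 4 * t) (P : ℕ → Prop) [DecidablePred P]
    (hP : ∀ k, P k → t < k) :
    (∑' k, if P k then degPMF β γ n k else 0)
      ≤ Real.exp 1 * Real.exp (-β * t ^ 2 / 4) := by
  have hE : HasSum (fun k : ℕ => (1 : ℝ) ^ k / (Nat.factorial k : ℝ)) (Real.exp 1) := by
    rw [Real.exp_eq_exp_ℝ]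
    exact NormedSpace.expSeries_div_hasSum_exp (1 : ℝ)
  have hE' := hE.mul_right (Real.exp (-β * t ^ 2 / 4))
  have hle : ∀ k, (if P k then degPMF β γ n k else 0)
      ≤ (1 : ℝ) ^ k / (Nat.factorial k : ℝ) * Real.exp (-β * t ^ 2 / 4) := fun k => by
    split_ifs with hk
    · refine (degPMF_le_degWeight hβ γ n k).trans ?_
      have htk := hP k hk
      rw [degWeight, one_pow]
      gcongr
      have h1 := mul_le_mul_of_nonneg_right h (Nat.cast_nonneg (α := ℝ) k)
      have h2 : β * (t * k) ≤ β * (k * k) := by gcongr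
      have h3 : β * t ^ 2 ≤ β * (k : ℝ) ^ 2 := by gcongr
      nlinarith
    · positivity
  refine (Summable.tsum_le_tsum hle ?_ hE'.summable).trans hE'.tsum_eq.le
  refine (hasSum_degPMF hβ γ n).summable.of_nonneg_of_le (fun k => ?_) fun k => ?_
  all_goals
    have := degPMF_nonneg hβ γ n k
    split_ifs <;> linarith

theorem eventually_log_le_rpow (a b : ℝ) {ε : ℝ} (hε : 0 < ε) :
    ∀ᶠ n : ℕ in atTop, a + b * Real.log n ≤ ε * (n : ℝ) ^ ((1 : ℝ) / 4) := by
  have h1 : (fun x : ℝ => a + b * Real.log x) =o[atTop] fun x : ℝ => x ^ ((1 : ℝ) / 4) := by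
    refine Asymptotics.IsLittleO.add ?_
      ((isLittleO_log_rpow_atTop (by norm_num)).const_mul_left b)
    refine Asymptotics.isLittleO_const_left.2 (Or.inr ?_)
    exact tendsto_norm_atTop_atTop.comp (tendsto_rpow_atTop (by norm_num))
  filter_upwards [tendsto_natCast_atTop_atTop.eventually (h1.def hε)] with n hn
  rw [Real.norm_of_nonneg (by positivity : (0 : ℝ) ≤ (n : ℝ) ^ ((1 : ℝ) / 4))] at hn
  exact (le_abs_self _).trans hn

open scoped Classical in
/-- **Lemma.** There exists a constant `K > 0`, independent of `n`, such that
`P(D ∈ A₂ᶜ) ≤ K n e^{-β√n/4}`, where `A₂ᶜ` is the event that `Dᵢ > n^{1/4}` for some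
`i = 1,…,n`, and `D₁,…,D_n` are iid with pmf `degPMF β (γ n) n`, the tilt `γ n` being
chosen so that `E[D₁] = c log n`. -/
theorem tail_bound (β c : ℝ) (hβ : 0 < β) (hc : 0 < c)
    (γ : ℕ → ℝ) (hγ : ∀ n, 0 < γ n)
    (hmean : ∀ n : ℕ, 2 ≤ n → degMean β (γ n) n = c * Real.log n) :
    ∃ K : ℝ, 0 < K ∧ ∀ n : ℕ, 2 ≤ n →
      (∑' d : Fin n → ℕ,
          if ∃ i : Fin n, (n : ℝ) ^ ((1 : ℝ) / 4) < (d i : ℝ) then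
            ∏ i : Fin n, degPMF β (γ n) n (d i)
          else 0)
        ≤ K * n * Real.exp (-β * Real.sqrt n / 4) := by
  obtain ⟨N, hN⟩ := eventually_atTop.1
    (eventually_log_le_rpow β ((1 + 2 * β) * c) (ε := 3 * β / 4) (by positivity))
  refine ⟨Real.exp 1 + Real.exp (β * Real.sqrt N / 4), by positivity, fun n hn => ?_⟩
  have hub := tsum_exists_prod_le n (degPMF β (γ n) n)
    (fun k => (n : ℝ) ^ ((1 : ℝ) / 4) < (k : ℝ)) (degPMF_nonneg hβ _ n) (hasSum_degPMF hβ _ n)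
  refine hub.trans ?_
  rw [mul_comm _ (n : ℝ), mul_assoc]
  refine mul_le_mul_of_nonneg_left ?_ (Nat.cast_nonneg n)
  rw [add_mul]
  rcases le_total N n with hNn | hNn
  · have ht : ((n : ℝ) ^ ((1 : ℝ) / 4)) ^ 2 = Real.sqrt n := by
      rw [Real.sqrt_eq_rpow, ← Real.rpow_natCast, ← Real.rpow_mul (Nat.cast_nonneg n)]
      norm_num
    have htilt := tilt_le_degMean hβ (γ n) n
    rw [hmean n hn, ← mul_assoc] at htilt
    have h := tail_degPMF_le hβ (γ n) n _ (by positivity) (htilt.trans (hN n hNn))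
      (fun k => (n : ℝ) ^ ((1 : ℝ) / 4) < (k : ℝ)) fun k hk => hk
    rw [ht] at h
    exact h.trans (le_add_of_nonneg_right (by positivity))
  · have hone : (∑' k : ℕ, if (n : ℝ) ^ ((1 : ℝ) / 4) < (k : ℝ) then degPMF β (γ n) n k else 0)
        ≤ 1 := by
      have hle : ∀ k : ℕ, (if (n : ℝ) ^ ((1 : ℝ) / 4) < (k : ℝ) then degPMF β (γ n) n k else 0)
          ≤ degPMF β (γ n) n k := fun k => by
        have := degPMF_nonneg hβ (γ n) n k
        split_ifs <;> linarith
      have hs := (hasSum_degPMF hβ (γ n) n).summable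
      refine (Summable.tsum_le_tsum hle (hs.of_nonneg_of_le (fun k => ?_) hle) hs).trans
        (hasSum_degPMF hβ (γ n) n).tsum_eq.le
      have := degPMF_nonneg hβ (γ n) n k
      split_ifs <;> linarith
    refine hone.trans (le_add_of_nonneg_of_le (by positivity) ?_)
    rw [← Real.exp_add, Real.one_le_exp_iff]
    have hsq : β * Real.sqrt n ≤ β * Real.sqrt N := by gcongr
    linarith
end

section
/- Define k_γ to be the smallest j for which f(j+1,γ)/f(j,γ) ≤ 1. Then for all integers j ≥ −k_γ, f(k_γ + j, γ)/f(k_γ, γ) ≤ e^{−β|j|(|j|−1)}. -/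
open Filter Real

theorem degWeight_succ_div (β γ : ℝ) (n k : ℕ) :
    degWeight β γ n (k + 1) / degWeight β γ n k =
      Real.exp (-β * (2 * k + 1) + γ * Real.log n) / (k + 1) := by
  rw [div_eq_iff (degWeight_pos β γ n k).ne']
  have h : -β * ((k + 1 : ℕ) : ℝ) ^ 2 + γ * Real.log n * ((k + 1 : ℕ) : ℝ) =
      (-β * (2 * k + 1) + γ * Real.log n) + (-β * (k : ℝ) ^ 2 + γ * Real.log n * k) := by
    push_cast
    ring
  rw [degWeight, degWeight, h, Real.exp_add, Nat.factorial_succ]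
  push_cast
  field_simp

/-- Consecutive ratios of the weights decay at least geometrically with rate `e^{-2β}`. -/
theorem degWeight_succ_div_add_le (β γ : ℝ) (n k i : ℕ) :
    degWeight β γ n (k + i + 1) / degWeight β γ n (k + i) ≤
      Real.exp (-β * (2 * i)) * (degWeight β γ n (k + 1) / degWeight β γ n k) := by
  rw [degWeight_succ_div, degWeight_succ_div, ← mul_div_assoc, ← Real.exp_add]
  push_cast
  have h : -β * (2 * (k + i : ℝ) + 1) + γ * Real.log n =
      -β * (2 * i) + (-β * (2 * k + 1) + γ * Real.log n) := by ring
  rw [h]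
  gcongr
  simp

theorem degWeight_add_le (β γ : ℝ) (n k : ℕ)
    (hk : degWeight β γ n (k + 1) / degWeight β γ n k ≤ 1) (i : ℕ) :
    degWeight β γ n (k + i) ≤ Real.exp (-β * i * (i - 1)) * degWeight β γ n k := by
  induction i with
  | zero => simp
  | succ i ih =>
    have hstep : degWeight β γ n (k + i + 1) / degWeight β γ n (k + i) ≤
        Real.exp (-β * (2 * i)) :=
      (degWeight_succ_div_add_le β γ n k i).trans
        (mul_le_of_le_one_right (Real.exp_pos _).le hk)
    rw [div_le_iff₀ (degWeight_pos β γ n _)] at hstep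
    have hexp : -β * ((i + 1 : ℕ) : ℝ) * (((i + 1 : ℕ) : ℝ) - 1) =
        -β * (2 * i) + -β * i * (i - 1) := by
      push_cast
      ring
    rw [hexp, Real.exp_add, mul_assoc]
    exact hstep.trans (mul_le_mul_of_nonneg_left ih (Real.exp_pos _).le)

theorem degWeight_le_of_add_eq (β γ : ℝ) (n k : ℕ)
    (hk : ∀ j < k, 1 < degWeight β γ n (j + 1) / degWeight β γ n j) (i : ℕ) :
    ∀ m, m + i = k → degWeight β γ n m ≤ Real.exp (-β * i * (i - 1)) * degWeight β γ n k := by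
  induction i with
  | zero =>
    rintro m rfl
    simp
  | succ i ih =>
    intro m hm
    have hratio := (hk (m + i) (by omega)).le.trans (degWeight_succ_div_add_le β γ n m i)
    rw [← mul_div_assoc, le_div_iff₀ (degWeight_pos β γ n _), one_mul] at hratio
    have hexp : -β * ((i + 1 : ℕ) : ℝ) * (((i + 1 : ℕ) : ℝ) - 1) =
        -β * (2 * i) + -β * i * (i - 1) := by
      push_cast
      ring
    rw [hexp, Real.exp_add, mul_assoc]
    exact hratio.trans (mul_le_mul_of_nonneg_left (ih (m + 1) (by omega)) (Real.exp_pos _).le)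

/-- **Lemma (Gaussian-type ratio bound).** Let `k_γ` be the smallest `j` for which
`f(j+1,γ)/f(j,γ) ≤ 1`, where `f(j,γ) = (1/j!) exp(-βj² + γ j log n)`. Then for all integers
`j ≥ -k_γ`, one has `f(k_γ + j, γ)/f(k_γ, γ) ≤ e^{-β|j|(|j|-1)}`. -/
theorem ratio_bound (β γ : ℝ) (hβ : 0 < β) (hγ : 0 < γ) (n : ℕ) (hn : 2 ≤ n)
    (k : ℕ)
    (hk₁ : degWeight β γ n (k + 1) / degWeight β γ n k ≤ 1)
    (hk₂ : ∀ j < k, 1 < degWeight β γ n (j + 1) / degWeight β γ n j) :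
    ∀ j : ℤ, -(k : ℤ) ≤ j →
      degWeight β γ n ((k : ℤ) + j).toNat / degWeight β γ n k ≤
        Real.exp (-β * |(j : ℝ)| * (|(j : ℝ)| - 1)) := by
  intro j hj
  rw [div_le_iff₀ (degWeight_pos β γ n k)]
  obtain ⟨i, rfl | rfl⟩ := j.eq_nat_or_neg
  · have hi : ((k : ℤ) + i).toNat = k + i := by omega
    simpa [hi] using degWeight_add_le β γ n k hk₁ i
  · have hi : ((k : ℤ) + -(i : ℤ)).toNat + i = k := by omega
    simpa using degWeight_le_of_add_eq β γ n k hk₂ i _ hi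
end

section
/- Var(D₁) remains bounded below by some strictly positive constant as n → ∞; combined with its boundedness above, there exist constants 0 < v₁ ≤ v₂ < ∞ such that v₁ ≤ Var(D₁) ≤ v₂ for all n sufficiently large. -/
open Filter Real

theorem summable_int_abs_pow_mul_geometric {q : ℝ} (h0 : 0 ≤ q) (h1 : q < 1) (e : ℕ) :
    Summable fun d : ℤ => |(d : ℝ)| ^ e * q ^ d.natAbs := by
  have h : Summable fun n : ℕ => (n : ℝ) ^ e * q ^ n :=
    summable_pow_mul_geometric_of_norm_lt_one e (by rwa [Real.norm_of_nonneg h0])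
  refine Summable.of_nat_of_neg ?_ ?_ <;> simpa using h

theorem int_sub_injective (m : ℕ) : Function.Injective fun k : ℕ => (k : ℤ) - m := by
  intro a b h
  simpa using h

theorem tsum_abs_sub_pow_mul_le {q : ℝ} (h0 : 0 ≤ q) (h1 : q < 1) (e m : ℕ) :
    (Summable fun k : ℕ => |(k : ℝ) - m| ^ e * q ^ ((k : ℤ) - m).natAbs) ∧
    ∑' k : ℕ, |(k : ℝ) - m| ^ e * q ^ ((k : ℤ) - m).natAbs ≤
      ∑' d : ℤ, |(d : ℝ)| ^ e * q ^ d.natAbs := by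
  have hs := summable_int_abs_pow_mul_geometric h0 h1 e
  constructor
  · simpa [Function.comp_def] using hs.comp_injective (int_sub_injective m)
  · simpa [Function.comp_def] using
      tsum_comp_le_tsum_of_inj hs (fun d => by positivity) (int_sub_injective m)

/-- A positive sequence whose consecutive ratios decrease geometrically has a mode, around which
it decays geometrically, and whose successor carries a comparable weight. -/
theorem exists_mode {w s : ℕ → ℝ} {q : ℝ} (hq0 : 0 < q) (hq1 : q < 1)
    (hw : ∀ k, 0 < w k) (hs : ∀ k, 0 < s k) (hws : ∀ k, w (k + 1) = s k * w k)
    (hle : ∀ k, s (k + 1) ≤ q * s k) (hge : ∀ k, q / 2 * s k ≤ s (k + 1)) (hs0 : q ≤ s 0) :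
    ∃ m : ℕ, (∀ k, w k ≤ w m * (q⁻¹ * q ^ ((k : ℤ) - m).natAbs)) ∧
      q / 2 * w m ≤ w (m + 1) := by
  have hgeom : ∀ k, s k ≤ q ^ k * s 0 := by
    intro k
    induction k with
    | zero => simp
    | succ k ih =>
      calc s (k + 1) ≤ q * s k := hle k
        _ ≤ q * (q ^ k * s 0) := by gcongr
        _ = _ := by ring
  have hex : ∃ k, s k < 1 := by
    obtain ⟨k, hk⟩ := exists_pow_lt_of_lt_one (inv_pos.2 (hs 0)) hq1
    refine ⟨k, (hgeom k).trans_lt ?_⟩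
    calc q ^ k * s 0 < (s 0)⁻¹ * s 0 := mul_lt_mul_of_pos_right hk (hs 0)
      _ = 1 := inv_mul_cancel₀ (hs 0).ne'
  classical
  obtain ⟨m, hm, hmin⟩ : ∃ m, s m < 1 ∧ ∀ k < m, 1 ≤ s k :=
    ⟨Nat.find hex, Nat.find_spec hex, fun k hk => not_lt.1 (Nat.find_min hex hk)⟩
  have hright : ∀ j, s (m + 1 + j) ≤ q := by
    intro j
    induction j with
    | zero => exact (hle m).trans (by nlinarith)
    | succ j ih => exact (hle _).trans (mul_le_of_le_one_right hq0.le (ih.trans hq1.le))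
  have hR : ∀ j, w (m + 1 + j) ≤ w m * q ^ j := by
    intro j
    induction j with
    | zero => rw [add_zero, hws]; nlinarith [hw m]
    | succ j ih =>
      calc w (m + 1 + (j + 1)) = s (m + 1 + j) * w (m + 1 + j) := hws _
        _ ≤ q * (w m * q ^ j) := mul_le_mul (hright j) ih (hw _).le hq0.le
        _ = _ := by ring
  have hL : ∀ j k, k + 1 + j = m → w k ≤ w m * q ^ j := by
    intro j
    induction j with
    | zero =>
      rintro k rfl
      rw [add_zero, hws]
      nlinarith [hw k, hmin k (by omega)]
    | succ j ih =>
      intro k hk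
      have h2 : 1 ≤ s (k + 1) := hmin _ (by omega)
      have h3 : w k ≤ q * w (k + 1) := by
        rw [hws]
        nlinarith [hw k, hle k]
      calc w k ≤ q * w (k + 1) := h3
        _ ≤ q * (w m * q ^ j) := by
          gcongr
          exact ih _ (by omega)
        _ = _ := by ring
  refine ⟨m, fun k => ?_, ?_⟩
  · have hpow : ∀ j : ℕ, q⁻¹ * q ^ (j + 1) = q ^ j := fun j => by
      rw [pow_succ', inv_mul_cancel_left₀ hq0.ne']
    rcases lt_trichotomy k m with h | rfl | h
    · obtain ⟨j, hj⟩ : ∃ j, k + 1 + j = m := ⟨m - (k + 1), by omega⟩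
      rw [show ((k : ℤ) - m).natAbs = j + 1 by omega, hpow]
      exact hL j k hj
    · have := (one_le_inv₀ hq0).2 hq1.le
      simpa using le_mul_of_one_le_right (hw k).le this
    · obtain ⟨j, rfl⟩ : ∃ j, k = m + 1 + j := ⟨k - (m + 1), by omega⟩
      rw [show (((m + 1 + j : ℕ) : ℤ) - m).natAbs = j + 1 by omega, hpow]
      exact hR j
  · rw [hws]
    refine mul_le_mul_of_nonneg_right ?_ (hw m).le
    cases m with
    | zero => linarith
    | succ i => exact le_trans (by nlinarith [hmin i (by omega)]) (hge i)

/-- Bounds on the variance of a distribution on `ℕ` with geometric decay around `m` and with an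
atom of mass at least `ε` at both `m` and `m + 1`. -/
theorem variance_bounds_of_geometric_decay {p : ℕ → ℝ} {q C ε : ℝ} {m : ℕ} (hq0 : 0 < q)
    (hq1 : q < 1) (hp : ∀ k, 0 ≤ p k) (hsum : HasSum p 1)
    (hdecay : ∀ k, p k ≤ C * q ^ ((k : ℤ) - m).natAbs)
    (hm : ε ≤ p m) (hm' : ε ≤ p (m + 1)) :
    ε / 2 ≤ ∑' k : ℕ, ((k : ℝ) - ∑' j : ℕ, (j : ℝ) * p j) ^ 2 * p k ∧
    ∑' k : ℕ, ((k : ℝ) - ∑' j : ℕ, (j : ℝ) * p j) ^ 2 * p k ≤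
      C * ∑' d : ℤ, |(d : ℝ)| ^ 2 * q ^ d.natAbs := by
  have hC : 0 ≤ C := by simpa using (hp m).trans (hdecay m)
  have hbound : ∀ e k : ℕ, |(k : ℝ) - m| ^ e * p k ≤
      C * (|(k : ℝ) - m| ^ e * q ^ ((k : ℤ) - m).natAbs) := fun e k => by
    calc |(k : ℝ) - m| ^ e * p k ≤ |(k : ℝ) - m| ^ e * (C * q ^ ((k : ℤ) - m).natAbs) := by
          gcongr
          exact hdecay k
      _ = _ := by ring
  have hmom : ∀ e : ℕ, Summable fun k : ℕ => |(k : ℝ) - m| ^ e * p k := fun e =>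
    Summable.of_nonneg_of_le (fun k => mul_nonneg (by positivity) (hp k)) (hbound e)
      ((tsum_abs_sub_pow_mul_le hq0.le hq1 e m).1.mul_left C)
  have hfirst : Summable fun k : ℕ => ((k : ℝ) - m) * p k := by
    refine Summable.of_norm ?_
    refine (hmom 1).congr fun k => ?_
    rw [norm_mul, Real.norm_eq_abs, Real.norm_of_nonneg (hp k), pow_one]
  have hmean : Summable fun k : ℕ => (k : ℝ) * p k :=
    (hfirst.add (hsum.summable.mul_left (m : ℝ))).congr fun k => by ring
  set μ : ℝ := ∑' j : ℕ, (j : ℝ) * p j with hμ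
  have hdiff : HasSum (fun k : ℕ => (μ - m) * (2 * ((k : ℝ) * p k) - (m + μ) * p k))
      ((μ - m) * (2 * μ - (m + μ) * 1)) :=
    ((hmean.hasSum.mul_left 2).sub (hsum.mul_left _)).mul_left _
  have hvar : HasSum (fun k : ℕ => ((k : ℝ) - μ) ^ 2 * p k)
      ((∑' k : ℕ, |(k : ℝ) - m| ^ 2 * p k) - (μ - m) * (2 * μ - (m + μ) * 1)) := by
    refine ((hmom 2).hasSum.sub hdiff).congr_fun ?_
    intro k
    rw [sq_abs]
    ring
  constructor
  · have h := hvar.summable.sum_le_tsum {m, m + 1}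
      (fun k _ => mul_nonneg (sq_nonneg _) (hp k))
    rw [Finset.sum_pair (by omega)] at h
    push_cast at h
    refine le_trans ?_ h
    have h1 := mul_le_mul_of_nonneg_left hm (sq_nonneg ((m : ℝ) - μ))
    have h2 := mul_le_mul_of_nonneg_left hm' (sq_nonneg ((m : ℝ) + 1 - μ))
    rcases le_or_gt ε 0 with hε | hε
    · have := mul_nonneg (sq_nonneg ((m : ℝ) - μ)) (hp m)
      have := mul_nonneg (sq_nonneg ((m : ℝ) + 1 - μ)) (hp (m + 1))
      linarith
    · nlinarith [mul_nonneg hε.le (sq_nonneg (2 * ((m : ℝ) - μ) + 1))]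
  · rw [hvar.tsum_eq]
    have h2 := (hmom 2).tsum_le_tsum (hbound 2)
      ((tsum_abs_sub_pow_mul_le hq0.le hq1 2 m).1.mul_left C)
    rw [tsum_mul_left] at h2
    have h3 := mul_le_mul_of_nonneg_left (tsum_abs_sub_pow_mul_le hq0.le hq1 2 m).2 hC
    nlinarith [sq_nonneg (μ - m)]

theorem degWeight_succ (β γ : ℝ) (n k : ℕ) :
    degWeight β γ n (k + 1) =
      Real.exp (γ * Real.log n - β * (2 * k + 1)) / (k + 1) * degWeight β γ n k := by
  unfold degWeight
  rw [show -β * ((k + 1 : ℕ) : ℝ) ^ 2 + γ * Real.log n * ((k + 1 : ℕ) : ℝ) =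
    (γ * Real.log n - β * (2 * k + 1)) + (-β * (k : ℝ) ^ 2 + γ * Real.log n * k) by
      push_cast; ring, Real.exp_add, Nat.factorial_succ]
  push_cast
  field_simp

theorem exists_degWeight_mode {β γ : ℝ} {n : ℕ} (hβ : 0 < β) (hθ : 0 ≤ γ * Real.log n) :
    ∃ m : ℕ, (∀ k, degWeight β γ n k ≤ degWeight β γ n m *
        ((Real.exp (-(2 * β)))⁻¹ * Real.exp (-(2 * β)) ^ ((k : ℤ) - m).natAbs)) ∧
      Real.exp (-(2 * β)) / 2 * degWeight β γ n m ≤ degWeight β γ n (m + 1) := by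
  have hstep : ∀ k : ℕ, Real.exp (γ * Real.log n - β * (2 * ((k + 1 : ℕ) : ℝ) + 1)) =
      Real.exp (-(2 * β)) * Real.exp (γ * Real.log n - β * (2 * k + 1)) := fun k => by
    rw [← Real.exp_add]
    push_cast
    ring_nf
  refine exists_mode (s := fun k : ℕ => Real.exp (γ * Real.log n - β * (2 * k + 1)) / (k + 1))
    (Real.exp_pos _) (Real.exp_lt_one_iff.2 (by linarith)) (degWeight_pos β γ n)
    (fun k => by positivity) (degWeight_succ β γ n) (fun k => ?_) (fun k => ?_) ?_
  · simp only [hstep]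
    rw [← mul_div_assoc]
    gcongr
    simp
  · simp only [hstep]
    rw [div_mul_div_comm]
    gcongr
    push_cast
    linarith [(k.cast_nonneg : (0 : ℝ) ≤ k)]
  · simp only [Nat.cast_zero, zero_add, div_one, mul_zero, mul_one]
    exact Real.exp_le_exp.2 (by linarith)

theorem degVar_bounds {β γ : ℝ} {n : ℕ} (hβ : 0 < β) (hθ : 0 ≤ γ * Real.log n) :
    let q := Real.exp (-(2 * β))
    q / 2 * (q⁻¹ * ∑' d : ℤ, |(d : ℝ)| ^ 0 * q ^ d.natAbs)⁻¹ / 2 ≤ degVar β γ n ∧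
      degVar β γ n ≤ q⁻¹ * ∑' d : ℤ, |(d : ℝ)| ^ 2 * q ^ d.natAbs := by
  intro q
  have hq0 : 0 < q := Real.exp_pos _
  have hq1 : q < 1 := Real.exp_lt_one_iff.2 (by linarith)
  obtain ⟨m, hdecay, hnext⟩ := exists_degWeight_mode hβ hθ
  change ∀ k, degWeight β γ n k ≤ degWeight β γ n m * (q⁻¹ * q ^ ((k : ℤ) - m).natAbs) at hdecay
  change q / 2 * degWeight β γ n m ≤ _ at hnext
  have hw := degWeight_pos β γ n
  obtain ⟨hgs, hgle⟩ := tsum_abs_sub_pow_mul_le hq0.le hq1 0 m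
  simp only [pow_zero, one_mul] at hgs hgle ⊢
  have hmaj := (hgs.mul_left q⁻¹).mul_left (degWeight β γ n m)
  have hsum : Summable (degWeight β γ n) :=
    Summable.of_nonneg_of_le (fun k => (hw k).le) hdecay hmaj
  have hFm : degWeight β γ n m ≤ ∑' j, degWeight β γ n j :=
    hsum.le_tsum m fun k _ => (hw k).le
  have hF : 0 < ∑' j, degWeight β γ n j := (hw m).trans_le hFm
  have hFle := hsum.tsum_le_tsum hdecay hmaj
  rw [tsum_mul_left, tsum_mul_left] at hFle
  set S : ℝ := ∑' d : ℤ, q ^ d.natAbs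
  have hFS : ∑' j, degWeight β γ n j ≤ degWeight β γ n m * (q⁻¹ * S) :=
    hFle.trans (by have := (hw m).le; gcongr)
  have hK : 0 < q⁻¹ * S := pos_of_mul_pos_right (hF.trans_le hFS) (hw m).le
  have hpm : (q⁻¹ * S)⁻¹ ≤ degPMF β γ n m := by
    unfold degPMF
    rw [inv_eq_one_div, div_le_div_iff₀ hK hF, one_mul]
    exact hFS
  have hpm' : q / 2 * (q⁻¹ * S)⁻¹ ≤ degPMF β γ n (m + 1) :=
    calc q / 2 * (q⁻¹ * S)⁻¹ ≤ q / 2 * degPMF β γ n m := by gcongr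
      _ = q / 2 * degWeight β γ n m / ∑' j, degWeight β γ n j := by
        unfold degPMF
        ring
      _ ≤ degPMF β γ n (m + 1) := by
        unfold degPMF
        gcongr
  refine variance_bounds_of_geometric_decay (p := degPMF β γ n) (m := m) hq0 hq1
    (fun k => (div_pos (hw k) hF).le) ?_ (fun k => ?_) ?_ hpm'
  · exact div_self hF.ne' ▸ hsum.hasSum.div_const (∑' j, degWeight β γ n j)
  · unfold degPMF
    rw [div_le_iff₀ hF, mul_comm]
    exact (hdecay k).trans (by gcongr)
  · refine le_trans ?_ hpm
    have := inv_pos.2 hK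
    nlinarith

/-- **Lemma (non-degenerate variance).** `Var(D₁)` is bounded below by a strictly positive
constant as `n → ∞`; combined with its boundedness above, there exist constants
`0 < v₁ ≤ v₂ < ∞` with `v₁ ≤ Var(D₁) ≤ v₂` for all `n` sufficiently large. -/
theorem variance_bounds (β : ℝ) (hβ : 0 < β) (γ : ℕ → ℝ) (hγ : ∀ n, 0 < γ n) :
    ∃ v₁ v₂ : ℝ, 0 < v₁ ∧ v₁ ≤ v₂ ∧ ∀ᶠ n : ℕ in Filter.atTop,
      v₁ ≤ degVar β (γ n) n ∧ degVar β (γ n) n ≤ v₂ := by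
  have hq0 : 0 < Real.exp (-(2 * β)) := Real.exp_pos _
  have hS : 0 < ∑' d : ℤ, |(d : ℝ)| ^ 0 * Real.exp (-(2 * β)) ^ d.natAbs :=
    (summable_int_abs_pow_mul_geometric hq0.le (Real.exp_lt_one_iff.2 (by linarith)) 0).tsum_pos
      (fun d => by positivity) 0 (by simp)
  have hbounds : ∀ n : ℕ, _ := fun n =>
    degVar_bounds (γ := γ n) (n := n) hβ (mul_nonneg (hγ n).le (Real.log_natCast_nonneg n))
  exact ⟨_, _, by positivity, (hbounds 0).1.trans (hbounds 0).2, Eventually.of_forall hbounds⟩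
end
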